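/- arXiv:0801.1634 — 3 statements merged into one kernel-verified Lean document; each statement's English description precedes it below -/
import Mathlib

section
/- Let k be a field of characteristic different from 2, let φ be an r-fold Pfister form over k, and let q, q' be nondegenerate quadratic forms over k of the same dimension. If φ ⊗ q is isometric to φ ⊗ q', then the product d(q)·d(q') of the determinants of q and q' is, modulo squares, a nonzero value represented by φ; that is, d(q)·d(q') ∈ D(φ)·(k*)². -/
open QuadraticMap

theorem LinearEquiv.quadraticMap_equivalent {k V W : Type*} [CommSemiring k] [AddCommMonoid V]
    [Module k V] [AddCommMonoid W] [Module k W] {Q : QuadraticMap k V k} {Q' : QuadraticMap k W k}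
    (e : V ≃ₗ[k] W) (h : ∀ x, Q' (e x) = Q x) : Q.Equivalent Q' :=
  ⟨{ e with map_app' := h }⟩

namespace QuadraticMap

section Equivalence

variable {k : Type*} [CommSemiring k] {V W X : Type*} [AddCommMonoid V] [Module k V]
  [AddCommMonoid W] [Module k W] [AddCommMonoid X] [Module k X]

theorem Equivalent.smul {Q : QuadraticMap k V k} {Q' : QuadraticMap k W k}
    (h : Q.Equivalent Q') (c : k) : (c • Q).Equivalent (c • Q') := by
  obtain ⟨e⟩ := h
  exact e.toLinearEquiv.quadraticMap_equivalent fun x => congrArg (c * ·) (e.map_app x)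

theorem equivalent_prod_assoc (P : QuadraticMap k V k) (Q : QuadraticMap k W k)
    (R : QuadraticMap k X k) : ((P.prod Q).prod R).Equivalent (P.prod (Q.prod R)) :=
  (LinearEquiv.prodAssoc k V W X).quadraticMap_equivalent fun x => by
    simp [add_assoc]

theorem equivalent_prod_left_comm (P : QuadraticMap k V k) (Q : QuadraticMap k W k)
    (R : QuadraticMap k X k) : (P.prod (Q.prod R)).Equivalent (Q.prod (P.prod R)) :=
  (equivalent_prod_assoc P Q R).symm.trans <|
    (Equivalent.prod ⟨IsometryEquiv.prodComm P Q⟩ (Equivalent.refl R)).trans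
      (equivalent_prod_assoc Q P R)

theorem equivalent_pi_cons {n : ℕ} (φ : QuadraticMap k V k) (c : k) (b : Fin n → k) :
    (QuadraticMap.pi fun i => (Fin.cons c b : Fin (n + 1) → k) i • φ).Equivalent
      ((c • φ).prod (QuadraticMap.pi fun i => b i • φ)) :=
  (Fin.consLinearEquiv k fun _ : Fin (n + 1) => V).symm.quadraticMap_equivalent fun x => by
    simp [Fin.consLinearEquiv, Fin.sum_univ_succ, Fin.tail]

end Equivalence

section Reflection

variable {k : Type*} [Field k] {V : Type*} [AddCommGroup V] [Module k V]

theorem exists_reflection (Q : QuadraticForm k V) {w : V} (hw : Q w ≠ 0) :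
    ∃ τ : V ≃ₗ[k] V, (∀ x, Q (τ x) = Q x) ∧ ∀ x, τ x = x - ((Q w)⁻¹ * polar Q w x) • w := by
  have h : ((Q w)⁻¹ • Q.polarBilin w) w = 2 := by
    simp [polar_self]; field_simp
  refine ⟨Module.reflection h, fun x => ?_, fun x => by simp [Module.reflection_apply]⟩
  have e := QuadraticMap.map_add Q x (-(((Q w)⁻¹ * polar Q w x) • w))
  rw [Module.reflection_apply, sub_eq_add_neg]
  simp only [LinearMap.smul_apply, polarBilin_apply_apply, smul_eq_mul]
  rw [e, QuadraticMap.map_neg, QuadraticMap.map_smul, polar_neg_right, polar_smul_right,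
    polar_comm Q x w]
  simp only [smul_eq_mul]
  field_simp
  ring

theorem exists_isometry_apply_eq [NeZero (2 : k)] (Q : QuadraticForm k V) {u v : V}
    (h : Q u = Q v) (hv : Q v ≠ 0) :
    ∃ τ : V ≃ₗ[k] V, (∀ x, Q (τ x) = Q x) ∧ τ u = v := by
  have hp : Q (u + v) = Q u + Q v + polar Q u v := QuadraticMap.map_add Q u v
  have hm : Q (u - v) = Q u + Q v - polar Q u v := by
    rw [sub_eq_add_neg, QuadraticMap.map_add Q, QuadraticMap.map_neg, polar_neg_right]; ring
  by_cases hw : Q (u - v) = 0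
  · have hw' : Q (u + v) ≠ 0 := by
      intro h0
      have : (2 * 2) * Q v = 0 := by linear_combination h0 + hw - hp - hm - 2 * h
      simp [hv, NeZero.ne (2 : k)] at this
    obtain ⟨τ, hτ, hτ'⟩ := Q.exists_reflection hw'
    refine ⟨τ.trans (LinearEquiv.neg k), fun x => by simp [hτ], ?_⟩
    have : polar Q (u + v) u = Q (u + v) := by
      rw [polar_add_left, polar_self, polar_comm Q v u, hp, ← h, nsmul_eq_mul]; push_cast; ring
    simp [hτ', this, hw']
  · obtain ⟨τ, hτ, hτ'⟩ := Q.exists_reflection hw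
    refine ⟨τ, hτ, ?_⟩
    have : polar Q (u - v) u = Q (u - v) := by
      rw [polar_sub_left, polar_self, polar_comm Q v u, hm, ← h, nsmul_eq_mul]; push_cast; ring
    simp [hτ', this, hw]

end Reflection

section Cancellation

universe u

variable {k : Type u} [Field k] {V W : Type u} [AddCommGroup V] [Module k V]
  [AddCommGroup W] [Module k W]

/-- A form is cancellable if it may be cancelled from orthogonal sums, up to isometry. -/
def Cancellable (Q : QuadraticForm k V) : Prop :=
  ∀ (M N : Type u) [AddCommGroup M] [Module k M] [AddCommGroup N] [Module k N]
    (A : QuadraticForm k M) (B : QuadraticForm k N),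
    (Q.prod A).Equivalent (Q.prod B) → A.Equivalent B

theorem Cancellable.of_equivalent {Q : QuadraticForm k V} {Q' : QuadraticForm k W}
    (hQ : Cancellable Q) (h : Q'.Equivalent Q) : Cancellable Q' :=
  fun M N _ _ _ _ A B hAB =>
    hQ M N A B <| (h.symm.prod (.refl A)).trans <| hAB.trans (h.prod (.refl B))

theorem Cancellable.prod {Q : QuadraticForm k V} {Q' : QuadraticForm k W}
    (hQ : Cancellable Q) (hQ' : Cancellable Q') : Cancellable (Q.prod Q') :=
  fun M N _ _ _ _ A B hAB =>
    hQ' M N A B <| hQ _ _ _ _ <| (equivalent_prod_assoc Q Q' A).symm.trans <|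
      hAB.trans (equivalent_prod_assoc Q Q' B)

theorem cancellable_smul_sq [NeZero (2 : k)] {c : k} (hc : c ≠ 0) :
    Cancellable (c • (sq : QuadraticForm k k)) := by
  rintro M N _ _ _ _ A B ⟨e⟩
  obtain ⟨τ, hτ, hτ'⟩ := exists_isometry_apply_eq ((c • (sq : QuadraticForm k k)).prod B)
    (u := e (1, 0)) (v := (1, 0)) (by rw [e.map_app]; simp) (by simpa using hc)
  let f : (k × M) ≃ₗ[k] k × N := e.toLinearEquiv.trans τ
  have hf (x) : ((c • (sq : QuadraticForm k k)).prod B) (f x) =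
      ((c • (sq : QuadraticForm k k)).prod A) x := (hτ _).trans (e.map_app x)
  have hf1 : f (1, 0) = (1, 0) := hτ'
  have hpol (x) : (f x).1 = x.1 := by
    have h := hf ((1, 0) + x)
    rw [map_add, hf1] at h
    have h' := hf x
    simp only [prod_apply, smul_apply, sq_apply, Prod.fst_add, Prod.snd_add, zero_add,
      smul_eq_mul] at h h'
    have : (2 * c) * ((f x).1 - x.1) = 0 := by linear_combination h - h'
    simpa [hc, sub_eq_zero, NeZero.ne (2 : k)] using this
  have hpol' (x) : (f.symm x).1 = x.1 := by simpa using (hpol (f.symm x)).symm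
  let g : M ≃ₗ[k] N := LinearEquiv.ofLinearMap
    (LinearMap.snd k k N ∘ₗ f.toLinearMap ∘ₗ LinearMap.inr k k M)
    (LinearMap.snd k k M ∘ₗ f.symm.toLinearMap ∘ₗ LinearMap.inr k k N)
    (by
      ext y
      have : ((0 : k), (f.symm (0, y)).2) = f.symm (0, y) := Prod.ext (hpol' (0, y)).symm rfl
      simp [this])
    (by
      ext y
      have : ((0 : k), (f (0, y)).2) = f (0, y) := Prod.ext (hpol (0, y)).symm rfl
      simp [this])
  refine g.quadraticMap_equivalent fun x => ?_
  have h := hf (0, x)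
  simp only [prod_apply, hpol] at h
  simpa [g] using h

end Cancellation

section Round

variable {k : Type*} [Field k] {V W : Type*} [AddCommGroup V] [Module k V]
  [AddCommGroup W] [Module k W]

/-- A form is round if every nonzero value it represents is the factor of a similarity. -/
def Round (Q : QuadraticForm k V) : Prop :=
  ∀ v, Q v ≠ 0 → ∃ T : V ≃ₗ[k] V, ∀ w, Q (T w) = Q v * Q w

theorem Round.of_equivalent {Q : QuadraticForm k V} {Q' : QuadraticForm k W}
    (hQ : Round Q) (h : Q'.Equivalent Q) : Round Q' := by
  obtain ⟨e⟩ := h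
  intro v hv
  obtain ⟨T, hT⟩ := hQ (e v) (by rwa [e.map_app])
  refine ⟨e.toLinearEquiv.trans (T.trans e.symm.toLinearEquiv), fun w => ?_⟩
  have h1 : Q' (e.symm (T (e w))) = Q (T (e w)) := e.symm.map_app _
  exact h1.trans (by rw [hT, e.map_app, e.map_app])

theorem round_sq : Round (sq : QuadraticForm k k) := fun v hv =>
  ⟨LinearEquiv.smulOfNeZero k k v (by rintro rfl; simp at hv), fun w => by
    simp; ring⟩

theorem Round.prod_smul {Q : QuadraticForm k V} (hQ : Round Q) (c : k) :
    Round (Q.prod (c • Q)) := by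
  rintro ⟨v₁, v₂⟩ hv
  simp only [prod_apply, smul_apply, smul_eq_mul] at hv ⊢
  by_cases h₂ : Q v₂ = 0
  · obtain ⟨T, hT⟩ := hQ v₁ (by simpa [h₂] using hv)
    exact ⟨T.prodCongr T, fun w => by simp [hT, h₂]; ring⟩
  obtain ⟨U, hU⟩ := hQ v₂ h₂
  by_cases h₁ : Q v₁ = 0
  · have hc : c ≠ 0 := by rintro rfl; simp [h₁] at hv
    refine ⟨(LinearEquiv.prodComm k V V).trans
      ((U.trans (LinearEquiv.smulOfNeZero k V c hc)).prodCongr U), fun w => ?_⟩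
    simp [hU, h₁, QuadraticMap.map_smul]
    ring
  obtain ⟨T, hT⟩ := hQ v₁ h₁
  set x := Q v₁
  set y := Q v₂
  have hd : 1 + c * y / x ≠ 0 := by
    intro h0
    apply hv
    field_simp at h0
    simpa using h0
  let m : (V × V) ≃ₗ[k] V × V := LinearEquiv.ofLinearMap
    (((LinearMap.fst k V V) - (c * y / x) • LinearMap.snd k V V).prod
      (LinearMap.fst k V V + LinearMap.snd k V V))
    ((1 + c * y / x)⁻¹ • ((LinearMap.fst k V V) + (c * y / x) • LinearMap.snd k V V).prod
      (LinearMap.snd k V V - LinearMap.fst k V V))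
    (by
      refine LinearMap.ext fun p => Prod.ext ?_ ?_ <;> simp <;> match_scalars <;> field_simp <;> ring)
    (by
      refine LinearMap.ext fun p => Prod.ext ?_ ?_ <;> simp <;> match_scalars <;> field_simp)
  refine ⟨((LinearEquiv.refl k V).prodCongr (T.trans U.symm)).trans (m.trans (T.prodCongr U)),
    fun w => ?_⟩
  have hz : y * Q (U.symm (T w.2)) = x * Q w.2 := by rw [← hU, U.apply_symm_apply, hT]
  simp only [LinearEquiv.trans_apply, LinearEquiv.prodCongr_apply, LinearEquiv.refl_apply]
  set z := U.symm (T w.2)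
  have e₁ : Q (w.1 - (c * y / x) • z) =
      Q w.1 + (c * y / x) ^ 2 * Q z - (c * y / x) * polar Q w.1 z := by
    rw [sub_eq_add_neg, QuadraticMap.map_add Q, QuadraticMap.map_neg, polar_neg_right,
      polar_smul_right, QuadraticMap.map_smul]
    simp only [smul_eq_mul]
    ring
  have hm : m (w.1, z) = (w.1 - (c * y / x) • z, w.1 + z) := rfl
  simp only [hm, hT, hU, e₁, QuadraticMap.map_add Q w.1 z]
  have hz' : Q z = x * Q w.2 / y := by field_simp; linear_combination hz
  rw [hz']
  field_simp
  ring

end Round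

section Multiples

variable {k : Type*} [Field k] {V : Type*} [AddCommGroup V] [Module k V] {φ : QuadraticForm k V}

theorem Round.smul_equivalent (hφ : Round φ) {x : k} (hx : x ≠ 0) (h : x ∈ Set.range φ) (c : k) :
    (c • φ).Equivalent ((c * x) • φ) := by
  obtain ⟨v, rfl⟩ := h
  obtain ⟨T, hT⟩ := hφ v hx
  refine Equivalent.symm (T.quadraticMap_equivalent fun w => ?_)
  simp [hT, mul_assoc]

theorem Round.mul_mem_range (hφ : Round φ) {x y : k} (hx : x ∈ Set.range φ)
    (hy : y ∈ Set.range φ) : x * y ∈ Set.range φ := by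
  obtain ⟨v, rfl⟩ := hx
  obtain ⟨w, rfl⟩ := hy
  by_cases hv : φ v = 0
  · exact ⟨0, by simp [hv]⟩
  · obtain ⟨T, hT⟩ := hφ v hv
    exact ⟨T w, hT w⟩

theorem mul_sq_mem_range {x : k} (hx : x ∈ Set.range φ) (c : k) : x * c ^ 2 ∈ Set.range φ := by
  obtain ⟨v, rfl⟩ := hx
  exact ⟨c • v, by simp [QuadraticMap.map_smul]; ring⟩

theorem mem_range_of_mul_sq {x c : k} (hc : c ≠ 0) (hx : x * c ^ 2 ∈ Set.range φ) :
    x ∈ Set.range φ := by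
  have h := mul_sq_mem_range hx c⁻¹
  rwa [mul_assoc, ← mul_pow, mul_inv_cancel₀ hc, one_pow, mul_one] at h

theorem smul_prod_smul_equivalent (φ : QuadraticForm k V) {a b : k}
    (hab : a + b ≠ 0) :
    ((a • φ).prod (b • φ)).Equivalent (((a + b) • φ).prod ((a * b * (a + b)) • φ)) := by
  refine Equivalent.symm ?_
  let m : (V × V) ≃ₗ[k] V × V := LinearEquiv.ofLinearMap
    ((LinearMap.fst k V V - b • LinearMap.snd k V V).prod
      (LinearMap.fst k V V + a • LinearMap.snd k V V))
    ((a + b)⁻¹ • ((a • LinearMap.fst k V V) + b • LinearMap.snd k V V).prod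
      (LinearMap.snd k V V - LinearMap.fst k V V))
    (by
      refine LinearMap.ext fun p => Prod.ext ?_ ?_ <;> simp <;> match_scalars <;> field_simp <;> ring)
    (by
      refine LinearMap.ext fun p => Prod.ext ?_ ?_ <;> simp <;> match_scalars <;> field_simp
      ring)
  refine m.quadraticMap_equivalent fun w => ?_
  have hm : m w = (w.1 - b • w.2, w.1 + a • w.2) := rfl
  rw [hm, sub_eq_add_neg]
  simp only [prod_apply, smul_apply, QuadraticMap.map_add φ, QuadraticMap.map_neg,
    polar_neg_right, polar_smul_right, QuadraticMap.map_smul, smul_eq_mul]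
  ring

/-- If `⟨b₀, …, bₙ⟩ ⊗ φ` represents `c ≠ 0` for a round form `φ`, then `c • φ` splits off. -/
theorem Round.exists_equivalent_cons (hφ : Round φ) {n : ℕ}
    (b : Fin (n + 1) → k) (hb : ∀ i, b i ≠ 0) {c : k} (hc : c ≠ 0)
    (hrep : c ∈ Set.range (QuadraticMap.pi fun i => b i • φ)) :
    ∃ d : Fin n → k, (∀ i, d i ≠ 0) ∧
      (QuadraticMap.pi fun i => b i • φ).Equivalent
        ((c • φ).prod (QuadraticMap.pi fun i => d i • φ)) ∧
      (∏ i, b i) * (c * ∏ i, d i) ∈ Set.range φ := by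
  induction n generalizing c with
  | zero =>
    obtain ⟨v, hv⟩ := hrep
    have hv' : b 0 * φ (v 0) = c := by simpa using hv
    have hx : φ (v 0) ≠ 0 := by rintro h; simp [h] at hv'; exact hc hv'.symm
    refine ⟨Fin.tail b, fun i => i.elim0, ?_, ?_⟩
    · have h := equivalent_pi_cons φ (b 0) (Fin.tail b)
      rw [Fin.cons_self_tail] at h
      have h' := hφ.smul_equivalent hx ⟨_, rfl⟩ (b 0)
      rw [hv'] at h'
      exact h.trans (h'.prod (.refl _))
    · have := mul_sq_mem_range (φ := φ) ⟨v 0, rfl⟩ (b 0)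
      convert this using 1
      simp [← hv']
      ring
  | succ n ih =>
    obtain ⟨v, hv⟩ := hrep
    have hcons := equivalent_pi_cons φ (b 0) (Fin.tail b)
    rw [Fin.cons_self_tail] at hcons
    have hprod : ∏ i, b i = b 0 * ∏ i, Fin.tail b i := Fin.prod_univ_succ b
    set x := φ (v 0) with hx
    set m := (QuadraticMap.pi fun i => Fin.tail b i • φ) (Fin.tail v) with hm
    have hxm : b 0 * x + m = c := by
      rw [← hv, hm, hx]
      simp [Fin.sum_univ_succ, Fin.tail]
    by_cases hm0 : m = 0
    · rw [hm0, add_zero] at hxm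
      have hx0 : x ≠ 0 := by rintro h; simp [h] at hxm; exact hc hxm.symm
      refine ⟨Fin.tail b, fun i => hb _, ?_, ?_⟩
      · have h' := hφ.smul_equivalent hx0 ⟨_, rfl⟩ (b 0)
        rw [hxm] at h'
        exact hcons.trans (h'.prod (.refl _))
      · have := mul_sq_mem_range (φ := φ) ⟨v 0, rfl⟩ (b 0 * ∏ i, Fin.tail b i)
        convert this using 1
        rw [hprod, ← hxm]
        ring
    obtain ⟨d, hd, he, hdet⟩ := ih (Fin.tail b) (fun i => hb _) hm0 ⟨_, rfl⟩
    have hsplit := hcons.trans ((Equivalent.refl (b 0 • φ)).prod he)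
    by_cases hx0 : x = 0
    · rw [hx0, mul_zero, zero_add] at hxm
      refine ⟨Fin.cons (b 0) d, Fin.cases (hb 0) hd, ?_, ?_⟩
      · rw [← hxm]
        exact hsplit.trans <| (equivalent_prod_left_comm _ _ _).trans <|
          (Equivalent.refl _).prod (equivalent_pi_cons φ (b 0) d).symm
      · convert mul_sq_mem_range hdet (b 0) using 1
        rw [hprod, Fin.prod_univ_succ, ← hxm]
        simp
        ring
    · have hd0 : b 0 * x * m * c ≠ 0 := by simp [hb, hx0, hm0, hc]
      refine ⟨Fin.cons (b 0 * x * m * c) d, Fin.cases hd0 hd, ?_, ?_⟩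
      · have h' := hφ.smul_equivalent hx0 ⟨_, rfl⟩ (b 0)
        have h2 := smul_prod_smul_equivalent φ (hxm.trans_ne hc)
        rw [hxm] at h2
        exact hsplit.trans <| (h'.prod (.refl _)).trans <| (equivalent_prod_assoc _ _ _).symm.trans <|
          (h2.prod (.refl _)).trans <| (equivalent_prod_assoc _ _ _).trans <|
          (Equivalent.refl _).prod (equivalent_pi_cons φ _ d).symm
      · convert mul_sq_mem_range (hφ.mul_mem_range hdet ⟨v 0, rfl⟩) (b 0 * c) using 1
        rw [hprod, Fin.prod_univ_succ, ← hx]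
        simp
        ring

end Multiples

section Pfister

universe u

variable {k : Type u} [Field k]

/-- The properties of Pfister forms which govern isometries between their multiples. -/
structure IsCancellableRound {V : Type u} [AddCommGroup V] [Module k V]
    (φ : QuadraticForm k V) : Prop where
  one_mem_range : 1 ∈ Set.range φ
  round : Round φ
  cancellable (c : k) : c ≠ 0 → Cancellable (c • φ)

namespace IsCancellableRound

variable {V W : Type u} [AddCommGroup V] [Module k V] [AddCommGroup W] [Module k W]
  {φ : QuadraticForm k V} {ψ : QuadraticForm k W}

theorem of_equivalent (hφ : IsCancellableRound φ) (h : ψ.Equivalent φ) :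
    IsCancellableRound ψ where
  one_mem_range := by
    obtain ⟨v, hv⟩ := hφ.one_mem_range
    obtain ⟨e⟩ := h
    exact ⟨e.symm v, by rw [e.symm.map_app, hv]⟩
  round := hφ.round.of_equivalent h
  cancellable c hc := (hφ.cancellable c hc).of_equivalent (h.smul c)

theorem sq [NeZero (2 : k)] : IsCancellableRound (QuadraticMap.sq : QuadraticForm k k) where
  one_mem_range := ⟨1, by simp⟩
  round := round_sq
  cancellable _ hc := cancellable_smul_sq hc

theorem prod_smul (hφ : IsCancellableRound φ) {c : k} (hc : c ≠ 0) :
    IsCancellableRound (φ.prod (c • φ)) where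
  one_mem_range := by
    obtain ⟨v, hv⟩ := hφ.one_mem_range
    exact ⟨(v, 0), by simp [hv]⟩
  round := hφ.round.prod_smul c
  cancellable d hd := by
    refine ((hφ.cancellable d hd).prod
      (hφ.cancellable (d * c) (mul_ne_zero hd hc))).of_equivalent
      ((LinearEquiv.refl k _).quadraticMap_equivalent fun x => ?_)
    simp [mul_add, mul_assoc]

theorem prod_mul_prod_mem_range (hφ : IsCancellableRound φ) {n : ℕ} (b b' : Fin n → k)
    (hb : ∀ i, b i ≠ 0) (hb' : ∀ i, b' i ≠ 0)
    (h : (QuadraticMap.pi fun i => b i • φ).Equivalent (QuadraticMap.pi fun i => b' i • φ)) :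
    (∏ i, b i) * ∏ i, b' i ∈ Set.range φ := by
  induction n with
  | zero => simpa using hφ.one_mem_range
  | succ n ih =>
    have hcons := equivalent_pi_cons φ (b' 0) (Fin.tail b')
    rw [Fin.cons_self_tail] at hcons
    have hrep : b' 0 ∈ Set.range (QuadraticMap.pi fun i => b i • φ) := by
      obtain ⟨v, hv⟩ := hφ.one_mem_range
      obtain ⟨e⟩ := h.trans hcons
      exact ⟨e.symm (v, 0), by rw [e.symm.map_app]; simp [hv]⟩
    obtain ⟨d, hd, he, hdet⟩ :=
      hφ.round.exists_equivalent_cons b hb (hb' 0) hrep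
    have hrec := ih d (Fin.tail b') hd (fun i => hb' _) <|
      hφ.cancellable (b' 0) (hb' 0) _ _ _ _ (he.symm.trans (h.trans hcons))
    refine mem_range_of_mul_sq (Finset.prod_ne_zero_iff.mpr fun i _ => hd i)
      (c := ∏ i, d i) ?_
    convert hφ.round.mul_mem_range hdet hrec using 1
    rw [Fin.prod_univ_succ b']
    simp only [Fin.tail]
    ring

end IsCancellableRound

theorem bijective_sum_elim_map_succ (r : ℕ) : Function.Bijective
    (Sum.elim (fun S : Finset (Fin r) => S.map (Fin.succEmb r))
      fun S : Finset (Fin r) => Finset.cons 0 (S.map (Fin.succEmb r)) (by simp [Fin.succ_ne_zero])) := by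
  constructor
  · rintro (S | S) (T | T) h
    · simpa using h
    · have := Finset.ext_iff.mp h 0
      simp [Fin.succ_ne_zero] at this
    · have := Finset.ext_iff.mp h 0
      simp [Fin.succ_ne_zero] at this
    · congr 1
      ext i
      simpa [Fin.succ_ne_zero] using Finset.ext_iff.mp h i.succ
  · intro S
    by_cases h0 : 0 ∈ S
    · refine ⟨.inr ({i | i.succ ∈ S} : Finset (Fin r)), ?_⟩
      ext i
      cases i using Fin.cases <;> simp [h0, Fin.succ_ne_zero]
    · refine ⟨.inl ({i | i.succ ∈ S} : Finset (Fin r)), ?_⟩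
      ext i
      cases i using Fin.cases <;> simp [h0, Fin.succ_ne_zero]

theorem weightedSumSquares_finset_equivalent {r : ℕ} (a : Fin (r + 1) → k) :
    (weightedSumSquares k fun S : Finset (Fin (r + 1)) => ∏ i ∈ S, a i).Equivalent
      ((weightedSumSquares k fun S : Finset (Fin r) => ∏ i ∈ S, a i.succ).prod
        (a 0 • weightedSumSquares k fun S : Finset (Fin r) => ∏ i ∈ S, a i.succ)) := by
  let e := Equiv.ofBijective _ (bijective_sum_elim_map_succ r)
  refine ((LinearEquiv.funCongrLeft k k e).trans
    (LinearEquiv.sumArrowLequivProdArrow _ _ k k)).quadraticMap_equivalent fun x => ?_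
  simp only [weightedSumSquares_apply, prod_apply, smul_apply]
  rw [← e.sum_comp, Fintype.sum_sum_type]
  simp [e, Finset.mul_sum, LinearMap.funLeft, mul_assoc]

theorem isCancellableRound_weightedSumSquares [NeZero (2 : k)] {r : ℕ} (a : Fin r → k)
    (ha : ∀ i, a i ≠ 0) : IsCancellableRound
      (weightedSumSquares k fun S : Finset (Fin r) => ∏ i ∈ S, a i) := by
  induction r with
  | zero =>
    refine IsCancellableRound.sq.of_equivalent <|
      (LinearEquiv.funUnique (Finset (Fin 0)) k k).quadraticMap_equivalent fun x => ?_
    simp [Finset.eq_empty_of_isEmpty]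
  | succ r ih =>
    exact ((ih (fun i => a i.succ) fun i => ha _).prod_smul (ha 0)).of_equivalent
      (weightedSumSquares_finset_equivalent a)

end Pfister

end QuadraticMap

theorem QuadraticForm.tmul_weightedSumSquares_equivalent {k V : Type*} [Field k]
    [Invertible (2 : k)] [AddCommGroup V] [Module k V] (φ : QuadraticForm k V) {n : ℕ}
    (b : Fin n → k) : QuadraticMap.Equivalent (φ.tmul (weightedSumSquares k b))
      (QuadraticMap.pi fun i => b i • φ) := by
  refine (TensorProduct.piScalarRight k k V (Fin n)).quadraticMap_equivalent fun x => ?_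
  suffices h : (QuadraticMap.pi fun i => b i • φ).comp
      (TensorProduct.piScalarRight k k V (Fin n)).toLinearMap =
      φ.tmul (weightedSumSquares k b) from DFunLike.congr_fun h x
  refine (QuadraticMap.associated_rightInverse k).injective ?_
  ext v i w j
  simp [QuadraticForm.associated_tmul, QuadraticMap.associated_comp, weightedSumSquares,
    QuadraticMap.proj, Pi.single_apply]
  rw [Finset.sum_mul]
  have h2 : (2 : k) ≠ 0 := Invertible.ne_zero 2
  refine Finset.sum_congr rfl fun c _ => ?_
  split_ifs
  · field_simp
    ring
  all_goals simp

theorem QuadraticMap.Equivalent.tmul {k V V' W W' : Type*} [Field k]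
    [Invertible (2 : k)] [AddCommGroup V] [Module k V] [AddCommGroup W] [Module k W]
    [AddCommGroup V'] [Module k V'] [AddCommGroup W'] [Module k W']
    {φ : QuadraticForm k V} {φ' : QuadraticForm k V'} {q : QuadraticForm k W}
    {q' : QuadraticForm k W'} (hφ : φ.Equivalent φ') (hq : q.Equivalent q') :
    QuadraticMap.Equivalent (φ.tmul q) (φ'.tmul q') := by
  obtain ⟨e⟩ := hφ
  obtain ⟨f⟩ := hq
  exact (TensorProduct.congr e.toLinearEquiv f.toLinearEquiv).quadraticMap_equivalent
    (QuadraticForm.tmul_tensorMap_apply e.toIsometry f.toIsometry)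

/-- Let `k` be a field of characteristic ≠ 2, `φ` an `r`-fold Pfister form
`⟨⟨a₁,…,a_r⟩⟩` over `k` (diagonalized by the products `∏_{i ∈ S} (-aᵢ)`), and `q, q'`
nondegenerate quadratic forms of the same dimension `n` (with diagonalizations `⟨b₁,…,bₙ⟩` and
`⟨b'₁,…,b'ₙ⟩`, so `d(q) = ∏ bᵢ`, `d(q') = ∏ b'ᵢ`).  If `φ ⊗ q ≅ φ ⊗ q'` then `d(q)·d(q')` is,
modulo squares, a nonzero value represented by `φ`: `d(q)·d(q') ∈ D(φ)·(k*)²`. -/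
theorem pfister_tensor_isometric_implies_det_product_represented
    (k : Type) [Field k] [Invertible (2 : k)]
    (r n : ℕ)
    (a : Fin r → k) (ha : ∀ i, a i ≠ 0)
    (V : Type) [AddCommGroup V] [Module k V]
    (φ : QuadraticForm k V)
    (hφ : φ.Equivalent
      (weightedSumSquares k (fun S : Finset (Fin r) => ∏ i ∈ S, (-a i))))
    (W W' : Type) [AddCommGroup W] [Module k W] [AddCommGroup W'] [Module k W']
    (q : QuadraticForm k W) (q' : QuadraticForm k W')
    (b b' : Fin n → k) (hb : ∀ i, b i ≠ 0) (hb' : ∀ i, b' i ≠ 0)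
    (hq : q.Equivalent (weightedSumSquares k b))
    (hq' : q'.Equivalent (weightedSumSquares k b'))
    (h : (φ.tmul q).Equivalent (φ.tmul q')) :
    ∃ (v : V) (c : k), φ v ≠ 0 ∧ c ≠ 0 ∧
      (∏ i, b i) * (∏ i, b' i) = φ v * c ^ 2 := by
  have : NeZero (2 : k) := ⟨Invertible.ne_zero 2⟩
  have hround := (isCancellableRound_weightedSumSquares (fun i => -a i)
    fun i => neg_ne_zero.mpr (ha i)).of_equivalent hφ
  have hpi := ((φ.tmul_weightedSumSquares_equivalent b).symm.trans
    ((Equivalent.refl φ).tmul hq.symm)).trans <| h.trans <|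
    ((Equivalent.refl φ).tmul hq').trans (φ.tmul_weightedSumSquares_equivalent b')
  obtain ⟨v, hv⟩ := hround.prod_mul_prod_mem_range b b' hb hb' hpi
  refine ⟨v, 1, ?_, one_ne_zero, by simp [hv]⟩
  rw [hv]
  exact mul_ne_zero (Finset.prod_ne_zero_iff.mpr fun i _ => hb i)
    (Finset.prod_ne_zero_iff.mpr fun i _ => hb' i)
end

section
/- Let k be a field of characteristic different from 2, K/k a separable quadratic field extension with nontrivial k-automorphism x ↦ x̄, and H, H' ∈ GLₙ(K) invertible hermitian matrices. Suppose there is a k-algebra isomorphism θ : Mₙ(K) → Mₙ(K) intertwining the adjoint involutions, i.e. θ(ad_H(X)) = ad_{H'}(θ(X)) for all X ∈ Mₙ(K). Then the trace forms q_H and q_{H'} are similar: q_{H'} is isometric to λ·q_H for some λ ∈ k*. -/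
open Matrix

section Helpers

variable {k K : Type*} [Field k] [Field K] [Algebra k K]

/-- Skolem–Noether for matrix algebras over a field: every automorphism is inner. -/
theorem Matrix.exists_isUnit_mul_eq_mul_of_algEquiv {n : ℕ}
    (φ : Matrix (Fin n) (Fin n) K ≃ₐ[K] Matrix (Fin n) (Fin n) K) :
    ∃ P : Matrix (Fin n) (Fin n) K, IsUnit P ∧ ∀ X, φ X * P = P * X := by
  let e : Matrix (Fin n) (Fin n) K ≃ₐ[K] Module.End K (Fin n → K) := Matrix.toLinAlgEquiv'
  obtain ⟨T, hT⟩ := ((e.symm.trans φ).trans e).eq_linearEquivConjAlgEquiv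
  refine ⟨e.symm T.toLinearMap, ?_, fun X ↦ ?_⟩
  · exact ((Module.End.isUnit_iff _).2 T.bijective).map e.symm
  · apply e.injective
    have h := DFunLike.congr_fun hT (e X)
    simp only [AlgEquiv.trans_apply, AlgEquiv.symm_apply_apply] at h
    rw [map_mul, map_mul, AlgEquiv.apply_symm_apply, h]
    refine LinearMap.ext fun x ↦ ?_
    simp [LinearEquiv.conjAlgEquiv_apply]

/-- An algebra automorphism of a matrix algebra acts on scalar matrices through an automorphism of
the base field. -/
theorem Matrix.exists_algEquiv_apply_scalar [FiniteDimensional k K] {n : ℕ} [NeZero n]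
    (θ : Matrix (Fin n) (Fin n) K ≃ₐ[k] Matrix (Fin n) (Fin n) K) :
    ∃ τ : K ≃ₐ[k] K, ∀ c, θ (algebraMap K _ c) = algebraMap K _ (τ c) := by
  have hcentral (c : K) : ∃ d : K, θ (algebraMap K _ c) = algebraMap K _ d := by
    have : θ (algebraMap K _ c) ∈ Set.range (Matrix.scalar (Fin n)) := by
      refine Matrix.mem_range_scalar_of_commute_single fun i j _ ↦ ?_
      obtain ⟨Y, hY⟩ := θ.surjective (Matrix.single i j 1)
      rw [← hY]
      exact Commute.map (Algebra.commutes c Y).symm θ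
    obtain ⟨d, hd⟩ := this
    exact ⟨d, hd.symm⟩
  choose t ht using hcentral
  have hinj : Function.Injective (algebraMap K (Matrix (Fin n) (Fin n) K)) :=
    FaithfulSMul.algebraMap_injective _ _
  let τ : K →ₐ[k] K :=
    { toFun := t
      map_one' := hinj (by rw [← ht]; simp)
      map_mul' := fun a b ↦ hinj (by rw [← ht]; simp [ht])
      map_zero' := hinj (by rw [← ht]; simp)
      map_add' := fun a b ↦ hinj (by rw [← ht]; simp [ht])
      commutes' := fun r ↦ hinj (by
        rw [← ht, ← IsScalarTower.algebraMap_apply, AlgEquiv.commutes]) }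
  exact ⟨AlgEquiv.ofBijective τ (Algebra.IsAlgebraic.algHom_bijective τ), ht⟩

/-- Skolem–Noether for automorphisms of a matrix algebra that are linear only over a subfield. -/
theorem Matrix.exists_algEquiv_isUnit_mul_eq_mul_map [FiniteDimensional k K] {n : ℕ} [NeZero n]
    (θ : Matrix (Fin n) (Fin n) K ≃ₐ[k] Matrix (Fin n) (Fin n) K) :
    ∃ (τ : K ≃ₐ[k] K) (P : Matrix (Fin n) (Fin n) K),
      IsUnit P ∧ ∀ X, θ X * P = P * X.map τ := by
  obtain ⟨τ, hτ⟩ := Matrix.exists_algEquiv_apply_scalar θ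
  let φ : Matrix (Fin n) (Fin n) K ≃ₐ[K] Matrix (Fin n) (Fin n) K :=
    AlgEquiv.ofRingEquiv (f := (τ.symm.mapMatrix.trans θ).toRingEquiv) (fun c ↦ by
      change θ ((algebraMap K (Matrix (Fin n) (Fin n) K) c).map τ.symm) = _
      have h := hτ (τ.symm c)
      rw [AlgEquiv.apply_symm_apply] at h
      refine Eq.trans (congrArg θ ?_) h
      rw [Matrix.algebraMap_eq_diagonal, Matrix.diagonal_map (map_zero _),
        Matrix.algebraMap_eq_diagonal]
      rfl)
  obtain ⟨P, hP, h⟩ := Matrix.exists_isUnit_mul_eq_mul_of_algEquiv φ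
  refine ⟨τ, P, hP, fun X ↦ ?_⟩
  rw [← h (X.map τ)]
  change _ = θ ((X.map τ).map τ.symm) * P
  congr 2
  ext i j
  simp

/-- The nontrivial automorphism of a separable quadratic extension has the base field as its
fixed field. -/
theorem exists_algebraMap_eq_of_apply_eq_self [Algebra.IsSeparable k K]
    [Algebra.IsQuadraticExtension k K] {σ : K ≃ₐ[k] K} (hσ : σ ≠ AlgEquiv.refl) {c : K}
    (hc : σ c = c) : ∃ a : k, algebraMap k K a = c := by
  have hcard : Nat.card (K ≃ₐ[k] K) = 2 := by
    rw [IsGalois.card_aut_eq_finrank, Algebra.IsQuadraticExtension.finrank_eq_two]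
  refine IntermediateField.mem_bot.1 ((IsGalois.mem_bot_iff_fixed c).2 fun τ ↦ ?_)
  obtain ⟨x, hx, huniv⟩ := (Nat.card_eq_two_iff' (1 : K ≃ₐ[k] K)).1 hcard
  by_cases h : τ = 1
  · simp [h]
  · rw [huniv τ h, ← huniv σ hσ, hc]

/-- A change of variables `P` turns the hermitian form of `H` into that of `P̄ᵀ H P`. -/
theorem Matrix.sum_map_mul_mulVec_conjTranspose_mul_mul {n : ℕ} (σ : K ≃ₐ[k] K)
    (H P : Matrix (Fin n) (Fin n) K) (x : Fin n → K) :
    ∑ i, σ ((P *ᵥ x) i) * (H *ᵥ (P *ᵥ x)) i =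
      ∑ i, σ (x i) * (((P.map σ)ᵀ * H * P) *ᵥ x) i := by
  have hP : (fun i ↦ σ ((P *ᵥ x) i)) = P.map σ *ᵥ (fun i ↦ σ (x i)) := by
    ext i
    exact RingHom.map_mulVec (σ : K →+* K) P x i
  change (fun i ↦ σ ((P *ᵥ x) i)) ⬝ᵥ (H *ᵥ (P *ᵥ x)) = (fun i ↦ σ (x i)) ⬝ᵥ _
  rw [hP, ← Matrix.vecMul_transpose, ← Matrix.dotProduct_mulVec, Matrix.mulVec_mulVec,
    Matrix.mulVec_mulVec, Matrix.mul_assoc]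

end Helpers

/-- Let `k` be a field of characteristic ≠ 2, `K/k` a separable quadratic
field extension with nontrivial `k`-automorphism `σ` (conjugation), and `H, H'` invertible
hermitian `n × n` matrices over `K` with trace forms `q_H, q_H'` (the `k`-quadratic forms on
`Kⁿ` with `q_H x = x̄ᵀ H x ∈ k`).  If some `k`-algebra automorphism `θ` of `Mₙ(K)` intertwines
the adjoint involutions `ad_H : X ↦ H⁻¹ X̄ᵀ H` and `ad_H'`, then the trace forms are similar:
`q_H' ≅ λ · q_H` for some `λ ∈ k*`. -/
theorem isomorphic_unitary_involutions_implies_similar_trace_forms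
    (k K : Type) [Field k] [Field K] [Algebra k K] (h2 : (2 : k) ≠ 0)
    [Algebra.IsSeparable k K] (hK2 : Module.finrank k K = 2)
    (σ : K ≃ₐ[k] K) (hσ : σ ≠ AlgEquiv.refl)
    (n : ℕ) (H H' : Matrix (Fin n) (Fin n) K)
    (hHherm : (H.map σ)ᵀ = H) (hH'herm : (H'.map σ)ᵀ = H')
    (hHunit : IsUnit H) (hH'unit : IsUnit H')
    (qH qH' : QuadraticForm k (Fin n → K))
    (hqH : ∀ x : Fin n → K,
      algebraMap k K (qH x) = ∑ i, σ (x i) * H.mulVec x i)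
    (hqH' : ∀ x : Fin n → K,
      algebraMap k K (qH' x) = ∑ i, σ (x i) * H'.mulVec x i)
    (θ : Matrix (Fin n) (Fin n) K ≃ₐ[k] Matrix (Fin n) (Fin n) K)
    (hθ : ∀ X : Matrix (Fin n) (Fin n) K,
      θ (H⁻¹ * (X.map σ)ᵀ * H) = H'⁻¹ * ((θ X).map σ)ᵀ * H') :
    ∃ lam : k, lam ≠ 0 ∧ qH'.Equivalent (lam • qH) := by
  rcases Nat.eq_zero_or_pos n with rfl | hn
  · refine ⟨1, one_ne_zero, ⟨⟨LinearEquiv.refl k _, fun x ↦ ?_⟩⟩⟩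
    obtain rfl : x = 0 := Subsingleton.elim _ _
    exact (QuadraticMap.map_zero (1 • qH)).trans (QuadraticMap.map_zero qH').symm
  have : NeZero n := ⟨hn.ne'⟩
  have : Algebra.IsQuadraticExtension k K := ⟨hK2⟩
  obtain ⟨τ, P, hP, hθP⟩ := Matrix.exists_algEquiv_isUnit_mul_eq_mul_map θ
  have hcomm (x : K) : τ (σ x) = σ (τ x) := by
    exact DFunLike.congr_fun (mul_comm' τ σ) x
  have hadj (A B : Matrix (Fin n) (Fin n) K) :
      ((A * B).map σ)ᵀ = (B.map σ)ᵀ * (A.map σ)ᵀ := by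
    rw [Matrix.map_mul, Matrix.transpose_mul]
  have hσσ (x : K) : σ (σ x) = x := by
    have hcard : Nat.card (K ≃ₐ[k] K) = 2 := by
      rw [IsGalois.card_aut_eq_finrank, hK2]
    have h := pow_card_eq_one' (x := σ)
    rw [hcard, pow_two] at h
    exact DFunLike.congr_fun h x
  have hadj_adj (A : Matrix (Fin n) (Fin n) K) : (((A.map σ)ᵀ).map σ)ᵀ = A := by
    ext i j
    simp [hσσ]
  have hHdet := (Matrix.isUnit_iff_isUnit_det _).1 hHunit
  have hH'det := (Matrix.isUnit_iff_isUnit_det _).1 hH'unit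
  set S := (P.map σ)ᵀ * H' * P with hS
  have hSunit : IsUnit S := by
    refine (IsUnit.mul ?_ hH'unit).mul hP
    exact Matrix.isUnit_transpose _ |>.2 (hP.map (σ.mapMatrix (m := Fin n)))
  have hSherm : (S.map σ)ᵀ = S := by
    rw [hS, hadj, hadj, hadj_adj, hH'herm, ← Matrix.mul_assoc]
  have hkey (X : Matrix (Fin n) (Fin n) K) :
      S * (H⁻¹ * (X.map σ)ᵀ * H).map τ = ((X.map τ).map σ)ᵀ * S := by
    rw [hS, Matrix.mul_assoc _ P, ← hθP, hθ]
    have h1 : ((X.map τ).map σ)ᵀ * ((P.map σ)ᵀ * H' * P)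
        = (((θ X * P).map σ)ᵀ) * H' * P := by
      rw [hθP, hadj]; simp only [Matrix.mul_assoc]
    rw [h1, hadj]
    simp only [Matrix.mul_assoc, Matrix.mul_nonsing_inv_cancel_left _ _ hH'det]
  have hHinv : H⁻¹.map τ * H.map τ = 1 := by
    rw [← Matrix.map_mul, Matrix.nonsing_inv_mul _ hHdet, Matrix.map_one _ (map_zero _) (map_one _)]
  have hHinv' : H.map τ * H⁻¹.map τ = 1 := mul_eq_one_comm.1 hHinv
  have hcentral (Z : Matrix (Fin n) (Fin n) K) :
      Commute Z (S * H⁻¹.map τ) := by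
    have h := hkey ((Z.map τ.symm).map σ)ᵀ
    have hZ1 : ((((Z.map τ.symm).map σ)ᵀ.map σ)ᵀ).map τ = Z := by
      rw [hadj_adj]; ext i j; simp
    have hZ2 : ((((Z.map τ.symm).map σ)ᵀ.map τ).map σ)ᵀ = Z := by
      ext i j; simp [hcomm, hσσ]
    rw [Matrix.map_mul, Matrix.map_mul, hZ1, hZ2] at h
    rw [Commute, SemiconjBy, ← Matrix.mul_assoc, ← h]
    simp only [Matrix.mul_assoc, hHinv', Matrix.mul_one]
  obtain ⟨c, hc⟩ := Matrix.mem_range_scalar_of_commute_single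
    (M := S * H⁻¹.map τ) fun i j _ ↦ hcentral _
  have hSc : S = c • H.map τ := by
    calc S = S * H⁻¹.map τ * H.map τ := by rw [Matrix.mul_assoc, hHinv, Matrix.mul_one]
      _ = c • H.map τ := by rw [← hc, Matrix.scalar_apply, Matrix.smul_eq_diagonal_mul]
  have hS0 : S ≠ 0 := hSunit.ne_zero
  have hHτ : ((H.map τ).map σ)ᵀ = H.map τ := by
    conv_rhs => rw [← hHherm]
    ext i j
    simp [hcomm]
  have hσc : σ c = c := by
    have h : σ c • H.map τ = c • H.map τ := by
      rw [← hSc, ← hSherm, hSc]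
      conv_lhs => rw [← hHτ]
      ext i j
      simp
    refine smul_left_injective K (fun h0 : H.map τ = 0 ↦ hS0 ?_) h
    rw [hSc, h0, smul_zero]
  obtain ⟨lam, hlam⟩ := exists_algebraMap_eq_of_apply_eq_self hσ hσc
  refine ⟨lam, ?_, ?_⟩
  · rintro rfl
    exact hS0 (by rw [hSc, ← hlam, map_zero, zero_smul])
  let e : (Fin n → K) ≃ₗ[k] (Fin n → K) :=
    (LinearEquiv.piCongrRight fun _ ↦ τ.toLinearEquiv).trans
      ((P.toLinearEquiv' hP.invertible).restrictScalars k)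
  have he (x : Fin n → K) : e x = P *ᵥ fun i ↦ τ (x i) := rfl
  refine QuadraticMap.Equivalent.symm ⟨⟨e, fun x ↦ ?_⟩⟩
  apply (algebraMap k K).injective
  change algebraMap k K (qH' (e x)) = algebraMap k K (lam * qH x)
  rw [hqH', he, Matrix.sum_map_mul_mulVec_conjTranspose_mul_mul, ← hS, hSc, map_mul, hlam,
    ← τ.commutes (qH x), hqH, map_sum, Finset.mul_sum]
  refine Finset.sum_congr rfl fun i _ ↦ ?_
  have : τ ((H *ᵥ x) i) = (H.map τ *ᵥ fun i ↦ τ (x i)) i :=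
    RingHom.map_mulVec (τ : K →+* K) H x i
  rw [map_mul, hcomm, this, Matrix.smul_mulVec, Pi.smul_apply, smul_eq_mul]
  ring
end

section
/- Let k be a field of characteristic different from 2, a, b ∈ k*, Q = (a,b)_k the quaternion algebra with conjugation x ↦ x̄, and H, H' ∈ GLₙ(Q) invertible hermitian matrices. Suppose there is a k-algebra isomorphism θ : Mₙ(Q) → Mₙ(Q) intertwining the adjoint involutions, i.e. θ(ad_H(X)) = ad_{H'}(θ(X)) for all X ∈ Mₙ(Q). Then the trace forms q_H and q_{H'} are similar: q_{H'} is isometric to λ·q_H for some λ ∈ k*. -/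
open Matrix Quaternion

section QuaternionAlgebra

variable {k : Type*} [Field k] {a b : k}

/-- The four coordinates of a quaternion as a linear combination of the standard basis. -/
theorem quaternionAlgebra_eq_smul_basis (x : ℍ[k, a, b]) :
    x = x.re • (⟨1, 0, 0, 0⟩ : ℍ[k, a, b]) + x.imI • (⟨0, 1, 0, 0⟩ : ℍ[k, a, b])
      + x.imJ • (⟨0, 0, 1, 0⟩ : ℍ[k, a, b]) + x.imK • (⟨0, 0, 0, 1⟩ : ℍ[k, a, b]) := by
  ext <;> simp

/-- The value of a bilinear map on the separability element
`1 ⊗ 1 + i ⊗ i⁻¹ + j ⊗ j⁻¹ + ij ⊗ (ij)⁻¹` of a quaternion algebra. -/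
def quaternionCasimir {M : Type*} [AddCommGroup M] [Module k M]
    (B : ℍ[k, a, b] →ₗ[k] ℍ[k, a, b] →ₗ[k] M) : M :=
  B ⟨1, 0, 0, 0⟩ ⟨1, 0, 0, 0⟩ + a⁻¹ • B ⟨0, 1, 0, 0⟩ ⟨0, 1, 0, 0⟩
    + b⁻¹ • B ⟨0, 0, 1, 0⟩ ⟨0, 0, 1, 0⟩ - (a⁻¹ * b⁻¹) • B ⟨0, 0, 0, 1⟩ ⟨0, 0, 0, 1⟩

theorem exists_quaternionBilinear_apply {M : Type*} [AddCommGroup M] [Module k M]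
    (B : ℍ[k, a, b] →ₗ[k] ℍ[k, a, b] →ₗ[k] M) :
    ∃ e : Fin 4 → Fin 4 → M, ∀ p q, B p q =
      p.re • (q.re • e 0 0 + q.imI • e 0 1 + q.imJ • e 0 2 + q.imK • e 0 3)
      + p.imI • (q.re • e 1 0 + q.imI • e 1 1 + q.imJ • e 1 2 + q.imK • e 1 3)
      + p.imJ • (q.re • e 2 0 + q.imI • e 2 1 + q.imJ • e 2 2 + q.imK • e 2 3)
      + p.imK • (q.re • e 3 0 + q.imI • e 3 1 + q.imJ • e 3 2 + q.imK • e 3 3) := by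
  let v : Fin 4 → ℍ[k, a, b] := ![⟨1, 0, 0, 0⟩, ⟨0, 1, 0, 0⟩, ⟨0, 0, 1, 0⟩, ⟨0, 0, 0, 1⟩]
  refine ⟨fun i j => B (v i) (v j), fun p q => ?_⟩
  conv_lhs => rw [quaternionAlgebra_eq_smul_basis p, quaternionAlgebra_eq_smul_basis q]
  simp only [map_add, map_smul, LinearMap.add_apply, LinearMap.smul_apply, v, cons_val]
  module

theorem quaternionCasimir_mul_comm (ha : a ≠ 0) (hb : b ≠ 0)
    {M : Type*} [AddCommGroup M] [Module k M]
    (B : ℍ[k, a, b] →ₗ[k] ℍ[k, a, b] →ₗ[k] M) (x : ℍ[k, a, b]) :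
    quaternionCasimir (B.comp (LinearMap.mulLeft k x)) =
      quaternionCasimir (B.compl₂ (LinearMap.mulRight k x)) := by
  obtain ⟨e, he⟩ := exists_quaternionBilinear_apply B
  simp only [quaternionCasimir, LinearMap.comp_apply, LinearMap.compl₂_apply,
    LinearMap.mulLeft_apply, LinearMap.mulRight_apply, he, QuaternionAlgebra.re_mul,
    QuaternionAlgebra.imI_mul, QuaternionAlgebra.imJ_mul, QuaternionAlgebra.imK_mul]
  match_scalars <;> field_simp <;> ring

theorem four_smul_eq_zero_of_quaternionCasimir (ha : a ≠ 0) (hb : b ≠ 0)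
    {M : Type*} [AddCommGroup M] [Module k M]
    (B : ℍ[k, a, b] →ₗ[k] ℍ[k, a, b] →ₗ[k] M)
    (h : ∀ p p', quaternionCasimir (B.compl₂ (LinearMap.mulLeftRight k (p, p'))) = 0) :
    (4 : k) • B 1 1 = 0 := by
  have key : (4 : k) • B ⟨1, 0, 0, 0⟩ ⟨1, 0, 0, 0⟩ =
      quaternionCasimir (B.compl₂ (LinearMap.mulLeftRight k (⟨1, 0, 0, 0⟩, ⟨1, 0, 0, 0⟩)))
      + a⁻¹ • quaternionCasimir
        (B.compl₂ (LinearMap.mulLeftRight k (⟨0, 1, 0, 0⟩, ⟨0, 1, 0, 0⟩)))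
      + b⁻¹ • quaternionCasimir
        (B.compl₂ (LinearMap.mulLeftRight k (⟨0, 0, 1, 0⟩, ⟨0, 0, 1, 0⟩)))
      - (a⁻¹ * b⁻¹) • quaternionCasimir
        (B.compl₂ (LinearMap.mulLeftRight k (⟨0, 0, 0, 1⟩, ⟨0, 0, 0, 1⟩))) := by
    obtain ⟨e, he⟩ := exists_quaternionBilinear_apply B
    simp only [quaternionCasimir, LinearMap.compl₂_apply, LinearMap.mulLeftRight_apply, he,
      QuaternionAlgebra.re_mul, QuaternionAlgebra.imI_mul, QuaternionAlgebra.imJ_mul,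
      QuaternionAlgebra.imK_mul, mul_zero, zero_mul, mul_one, add_zero, zero_add,
      sub_zero, zero_sub, zero_smul, one_smul]
    match_scalars <;> field_simp <;> ring
  rw [show (1 : ℍ[k, a, b]) = ⟨1, 0, 0, 0⟩ from rfl, key]
  simp only [h, smul_zero, add_zero, sub_zero]

/-- Averaging the conjugates of `x` by the standard basis gives four times its real part. -/
theorem quaternion_sum_conj_basis (ha : a ≠ 0) (hb : b ≠ 0) (x : ℍ[k, a, b]) :
    quaternionCasimir
      ((LinearMap.mul k ℍ[k, a, b]).comp (LinearMap.mulRight k x)) =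
      algebraMap k ℍ[k, a, b] (4 * x.re) := by
  rw [Algebra.algebraMap_eq_smul_one]
  ext <;> simp [quaternionCasimir] <;> field_simp <;> ring

theorem quaternion_exists_re_mul_ne_zero (ha : a ≠ 0) (hb : b ≠ 0) {x : ℍ[k, a, b]}
    (hx : x ≠ 0) : ∃ y : ℍ[k, a, b], (x * y).re ≠ 0 := by
  by_contra! h
  apply hx
  have h0 := h ⟨1, 0, 0, 0⟩
  have h1 := h ⟨0, 1, 0, 0⟩
  have h2 := h ⟨0, 0, 1, 0⟩
  have h3 := h ⟨0, 0, 0, 1⟩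
  simp [ha, hb] at h0 h1 h2 h3
  ext <;> simp [*]

theorem quaternion_isSimpleRing (h2 : (2 : k) ≠ 0) (ha : a ≠ 0) (hb : b ≠ 0) :
    IsSimpleRing ℍ[k, a, b] := by
  refine .of_eq_bot_or_eq_top fun I => ?_
  rw [or_iff_not_imp_left, ← I.one_mem_iff]
  intro hI
  obtain ⟨x, hxI, hx⟩ := SetLike.exists_of_lt (bot_lt_iff_ne_bot.mpr hI : ⊥ < I)
  obtain ⟨y, hy⟩ := quaternion_exists_re_mul_ne_zero ha hb hx
  have smul_mem (c : k) {z : ℍ[k, a, b]} (hz : z ∈ I) : c • z ∈ I := by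
    rw [Algebra.smul_def]
    exact I.mul_mem_left _ _ hz
  have h4 : (4 : k) ≠ 0 := by
    rw [show (4 : k) = 2 * 2 by norm_num]
    exact mul_ne_zero h2 h2
  have conj_mem (p q : ℍ[k, a, b]) : p * (x * y) * q ∈ I :=
    I.mul_mem_right _ _ (I.mul_mem_left _ _ (I.mul_mem_right _ _ hxI))
  have hmem : algebraMap k ℍ[k, a, b] (4 * (x * y).re) ∈ I := by
    rw [← quaternion_sum_conj_basis ha hb]
    exact I.sub_mem (I.add_mem (I.add_mem (conj_mem _ _) (smul_mem _ (conj_mem _ _)))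
      (smul_mem _ (conj_mem _ _))) (smul_mem _ (conj_mem _ _))
  have := I.mul_mem_left (algebraMap k ℍ[k, a, b] (4 * (x * y).re)⁻¹) _ hmem
  rwa [← map_mul, inv_mul_cancel₀ (mul_ne_zero h4 hy), map_one] at this

/-- A quaternion commuting with `i` and `j` is a scalar. -/
theorem quaternion_eq_algebraMap_of_commute (h2 : (2 : k) ≠ 0) (ha : a ≠ 0)
    {x : ℍ[k, a, b]} (hx : ∀ y, x * y = y * x) : x = algebraMap k ℍ[k, a, b] x.re := by
  have hi := hx ⟨0, 1, 0, 0⟩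
  have hj := hx ⟨0, 0, 1, 0⟩
  simp [QuaternionAlgebra.ext_iff] at hi hj
  have eq_zero {c : k} (h : -c = c) : c = 0 :=
    (mul_eq_zero.mp (show 2 * c = 0 by linear_combination -h)).resolve_left h2
  have hI := eq_zero hj.2.symm
  have hJ := eq_zero hi.2
  have hK := (mul_eq_zero.mp (eq_zero hi.1)).resolve_left ha
  ext <;> simp [hI, hJ, hK, QuaternionAlgebra.algebraMap_eq]

end QuaternionAlgebra

/-- A nonzero element intertwining an automorphism of a simple ring with the identity is
invertible. -/
theorem IsSimpleRing.exists_inverse_of_intertwining {A : Type*} [Ring A] [IsSimpleRing A]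
    (θ : A ≃+* A) {P : A} (hP : P ≠ 0) (h : ∀ X, θ X * P = P * X) :
    ∃ R, P * R = 1 ∧ R * P = 1 := by
  let I : TwoSidedIdeal A := .mk' {Y | ∃ X, X * P = Y} ⟨0, zero_mul _⟩
    (by rintro _ _ ⟨X, rfl⟩ ⟨Y, rfl⟩; exact ⟨X + Y, add_mul _ _ _⟩)
    (by rintro _ ⟨X, rfl⟩; exact ⟨-X, neg_mul _ _⟩)
    (by rintro X _ ⟨Y, rfl⟩; exact ⟨X * Y, mul_assoc _ _ _⟩)
    (by rintro _ Y ⟨X, rfl⟩; exact ⟨X * θ Y, by rw [mul_assoc, h, mul_assoc]⟩)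
  have hPI : P ∈ I := by
    rw [TwoSidedIdeal.mem_mk']
    exact ⟨1, one_mul _⟩
  have h1 := IsSimpleRing.one_mem_of_ne_zero_mem I hP hPI
  rw [TwoSidedIdeal.mem_mk'] at h1
  obtain ⟨R, hR⟩ := h1
  have hR' : P * θ.symm R = 1 := by rw [← h, θ.apply_symm_apply, hR]
  refine ⟨R, ?_, hR⟩
  rwa [left_inv_eq_right_inv hR hR']

section MatrixQuaternion

variable {k : Type*} [Field k] {a b : k} {n : Type*} [Fintype n] [DecidableEq n]

/-- The bilinear map `(p, q) ↦ θ (p E_{ij}) y (q E_{lm})`. -/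
def sandwichSingle (θ : Matrix n n ℍ[k, a, b] →ₐ[k] Matrix n n ℍ[k, a, b])
    (y : Matrix n n ℍ[k, a, b]) (i j l m : n) :
    ℍ[k, a, b] →ₗ[k] ℍ[k, a, b] →ₗ[k] Matrix n n ℍ[k, a, b] :=
  LinearMap.mk₂ k (fun p q => θ (single i j p) * y * single l m q)
    (by intros; simp [single_add, add_mul])
    (by intros; rw [← smul_single, map_smul, smul_mul_assoc, smul_mul_assoc])
    (by intros; rw [single_add, mul_add])
    (by intros; rw [← smul_single, mul_smul_comm])

theorem sandwichSingle_apply (θ : Matrix n n ℍ[k, a, b] →ₐ[k] Matrix n n ℍ[k, a, b])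
    (y : Matrix n n ℍ[k, a, b]) (i j l m : n) (p q : ℍ[k, a, b]) :
    sandwichSingle θ y i j l m p q = θ (single i j p) * y * single l m q := rfl

/-- An average of `y` intertwining `θ` with the identity. -/
def intertwiner (θ : Matrix n n ℍ[k, a, b] →ₐ[k] Matrix n n ℍ[k, a, b])
    (o : n) (y : Matrix n n ℍ[k, a, b]) : Matrix n n ℍ[k, a, b] :=
  ∑ r, quaternionCasimir (sandwichSingle θ y r o o r)

theorem intertwiner_comm (ha : a ≠ 0) (hb : b ≠ 0)
    (θ : Matrix n n ℍ[k, a, b] →ₐ[k] Matrix n n ℍ[k, a, b])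
    (o : n) (y X : Matrix n n ℍ[k, a, b]) :
    θ X * intertwiner θ o y = intertwiner θ o y * X := by
  induction X using Matrix.induction_on' with
  | h_zero => simp
  | h_add X Y hX hY => rw [map_add, add_mul, hX, hY, mul_add]
  | h_std_basis i j x =>
    have hl (r : n) : θ (single i j x) * quaternionCasimir (sandwichSingle θ y r o o r) =
        if r = j then quaternionCasimir
          ((sandwichSingle θ y i o o j).comp (LinearMap.mulLeft k x)) else 0 := by
      simp only [quaternionCasimir, sandwichSingle_apply, LinearMap.comp_apply,
        LinearMap.mulLeft_apply, mul_add, mul_sub, mul_smul_comm, ← mul_assoc, ← map_mul]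
      split_ifs with h
      · subst h
        simp only [single_mul_single_same]
      · simp [single_mul_single_of_ne _ _ _ _ (Ne.symm h)]
    have hr (r : n) : quaternionCasimir (sandwichSingle θ y r o o r) * single i j x =
        if r = i then quaternionCasimir
          ((sandwichSingle θ y i o o j).compl₂ (LinearMap.mulRight k x)) else 0 := by
      simp only [quaternionCasimir, sandwichSingle_apply, LinearMap.compl₂_apply,
        LinearMap.mulRight_apply, add_mul, sub_mul, smul_mul_assoc, mul_assoc]
      split_ifs with h
      · subst h
        simp only [single_mul_single_same]
      · simp [single_mul_single_of_ne _ _ _ _ h]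
    rw [intertwiner, Finset.mul_sum, Finset.sum_mul]
    simp only [hl, hr, Finset.sum_ite_eq', Finset.mem_univ, if_true,
      quaternionCasimir_mul_comm ha hb]

theorem exists_intertwiner_ne_zero (h2 : (2 : k) ≠ 0) (ha : a ≠ 0) (hb : b ≠ 0)
    (θ : Matrix n n ℍ[k, a, b] →ₐ[k] Matrix n n ℍ[k, a, b])
    (hθ : Function.Injective θ) (o : n) : ∃ y, intertwiner θ o y ≠ 0 := by
  by_contra! h
  have h4 : (4 : k) ≠ 0 := by
    rw [show (4 : k) = 2 * 2 by norm_num]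
    exact mul_ne_zero h2 h2
  have hs (s : n) : θ (single o o 1) * single s s 1 = 0 := by
    have h40 := four_smul_eq_zero_of_quaternionCasimir ha hb (sandwichSingle θ 1 o o s s) ?_
    · simpa [sandwichSingle_apply, h4] using h40
    intro p p'
    have hr (r : n) : quaternionCasimir (sandwichSingle θ (single s o p) r o o r) *
        single o s p' = if r = o then quaternionCasimir
          ((sandwichSingle θ 1 o o s s).compl₂ (LinearMap.mulLeftRight k (p, p'))) else 0 := by
      simp only [quaternionCasimir, sandwichSingle_apply, LinearMap.compl₂_apply,
        LinearMap.mulLeftRight_apply, add_mul, sub_mul, smul_mul_assoc, mul_assoc]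
      split_ifs with hro
      · subst hro
        simp only [single_mul_single_same, one_mul]
      · simp [single_mul_single_of_ne _ _ _ _ hro]
    have h0 := congrArg (· * single o s p') (h (single s o p))
    simpa only [intertwiner, Finset.sum_mul, hr, Finset.sum_ite_eq', Finset.mem_univ, if_true,
      zero_mul] using h0
  have hz : θ (single o o 1) = 0 := by
    rw [← mul_one (θ (single o o 1)), ← Matrix.sum_single_one, Finset.mul_sum]
    exact Finset.sum_eq_zero fun s _ => hs s
  have := congrFun₂ ((map_eq_zero_iff θ hθ).mp hz) o o
  simp at this

/-- The Skolem–Noether theorem for matrix algebras over a quaternion algebra. -/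
theorem exists_inverse_intertwining_quaternionMatrix [Nonempty n] (h2 : (2 : k) ≠ 0)
    (ha : a ≠ 0) (hb : b ≠ 0) (θ : Matrix n n ℍ[k, a, b] ≃ₐ[k] Matrix n n ℍ[k, a, b]) :
    ∃ P R : Matrix n n ℍ[k, a, b], P * R = 1 ∧ R * P = 1 ∧ ∀ X, θ X * P = P * X := by
  have := quaternion_isSimpleRing h2 ha hb
  have o : n := Classical.arbitrary n
  obtain ⟨y, hy⟩ := exists_intertwiner_ne_zero h2 ha hb θ.toAlgHom θ.injective o
  have hcomm := intertwiner_comm ha hb θ.toAlgHom o y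
  obtain ⟨R, hPR, hRP⟩ := IsSimpleRing.exists_inverse_of_intertwining θ.toRingEquiv hy hcomm
  exact ⟨_, R, hPR, hRP, hcomm⟩

/-- A quaternionic matrix commuting with all matrices is a scalar. -/
theorem exists_eq_algebraMap_of_commute_quaternionMatrix (h2 : (2 : k) ≠ 0)
    (ha : a ≠ 0) {Z : Matrix n n ℍ[k, a, b]} (hZ : ∀ X, Z * X = X * Z) :
    ∃ c : k, Z = algebraMap k _ c := by
  obtain h | h := isEmpty_or_nonempty n
  · exact ⟨0, Subsingleton.elim _ _⟩
  obtain ⟨x, rfl⟩ := mem_range_scalar_iff_commute_single'.mpr fun i j => (hZ (single i j 1)).symm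
  obtain ⟨o⟩ := h
  have hx (y : ℍ[k, a, b]) : x * y = y * x := by
    simpa using congrFun₂ (hZ (single o o y)) o o
  refine ⟨x.re, ?_⟩
  rw [quaternion_eq_algebraMap_of_commute h2 ha hx, algebraMap_eq_diagonal]
  simp [Pi.algebraMap_def]

end MatrixQuaternion

/-- Let `k` be a field of characteristic ≠ 2, `Q = (a,b)_k` a quaternion
algebra with its standard conjugation `star`, and `H, H'` invertible hermitian `n × n` matrices
over `Q` (with two-sided inverses `G, G'`) and trace forms `q_H, q_H'` (the `k`-quadratic forms
on `Qⁿ` with `q_H x = x̄ᵀ H x ∈ k·1`).  If some `k`-algebra automorphism `θ` of `Mₙ(Q)`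
intertwines the adjoint involutions `ad_H : X ↦ H⁻¹ Xᴴ H` and `ad_H'`, then the trace forms are
similar: `q_H' ≅ λ · q_H` for some `λ ∈ k*`. -/
theorem quaternion_isomorphic_involutions_implies_similar_trace_forms
    (k : Type) [Field k] (h2 : (2 : k) ≠ 0)
    (a b : k) (ha : a ≠ 0) (hb : b ≠ 0)
    (n : ℕ) (H G H' G' : Matrix (Fin n) (Fin n) ℍ[k, a, b])
    (hHG : H * G = 1) (hGH : G * H = 1)
    (hH'G' : H' * G' = 1) (hG'H' : G' * H' = 1)
    (hHherm : Hᴴ = H) (hH'herm : H'ᴴ = H')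
    (qH qH' : QuadraticForm k (Fin n → ℍ[k, a, b]))
    (hqH : ∀ x : Fin n → ℍ[k, a, b],
      algebraMap k ℍ[k, a, b] (qH x) = ∑ i, star (x i) * H.mulVec x i)
    (hqH' : ∀ x : Fin n → ℍ[k, a, b],
      algebraMap k ℍ[k, a, b] (qH' x) = ∑ i, star (x i) * H'.mulVec x i)
    (θ : Matrix (Fin n) (Fin n) ℍ[k, a, b] ≃ₐ[k] Matrix (Fin n) (Fin n) ℍ[k, a, b])
    (hθ : ∀ X : Matrix (Fin n) (Fin n) ℍ[k, a, b],
      θ (G * Xᴴ * H) = G' * (θ X)ᴴ * H') :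
    ∃ lam : k, lam ≠ 0 ∧ qH'.Equivalent (lam • qH) := by
  obtain h | h := isEmpty_or_nonempty (Fin n)
  · refine ⟨1, one_ne_zero, ⟨⟨LinearEquiv.refl k _, fun x => ?_⟩⟩⟩
    simp [Subsingleton.elim x 0]
  obtain ⟨P, R, hPR, hRP, hP⟩ := exists_inverse_intertwining_quaternionMatrix h2 ha hb θ
  have hθP (X) : θ X = P * X * R := by rw [← hP, mul_assoc, hPR, mul_one]
  have hstar : Pᴴ * Rᴴ = 1 := by rw [← conjTranspose_mul, hRP, conjTranspose_one]
  have hcomm (X : Matrix (Fin n) (Fin n) ℍ[k, a, b]) :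
      (Pᴴ * H' * P * G) * X = X * (Pᴴ * H' * P * G) := by
    have h1 := hθ Xᴴ
    rw [hθP, hθP, conjTranspose_mul, conjTranspose_mul, conjTranspose_conjTranspose] at h1
    calc (Pᴴ * H' * P * G) * X
        = Pᴴ * H' * P * G * X * (H * (R * P) * G) := by rw [hRP, mul_one, hHG, mul_one]
      _ = Pᴴ * H' * (P * (G * X * H) * R) * P * G := by simp only [mul_assoc]
      _ = Pᴴ * (H' * G') * Rᴴ * X * Pᴴ * H' * P * G := by rw [h1]; simp only [mul_assoc]
      _ = X * (Pᴴ * H' * P * G) := by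
        rw [hH'G', mul_one, hstar, one_mul]; simp only [mul_assoc]
  obtain ⟨c, hc⟩ := exists_eq_algebraMap_of_commute_quaternionMatrix h2 ha hcomm
  have hPH : Pᴴ * H' * P = c • H := by
    rw [← mul_one (Pᴴ * H' * P), ← hGH, ← mul_assoc, hc, Algebra.smul_def]
  have hq (x : Fin n → ℍ[k, a, b]) : qH' (P *ᵥ x) = c * qH x := by
    apply FaithfulSMul.algebraMap_injective k ℍ[k, a, b]
    rw [map_mul, hqH, hqH']
    change star (P *ᵥ x) ⬝ᵥ (H' *ᵥ (P *ᵥ x)) = _ * (star x ⬝ᵥ (H *ᵥ x))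
    rw [star_mulVec, ← dotProduct_mulVec, mulVec_mulVec, mulVec_mulVec, hPH,
      smul_mulVec, dotProduct_smul, Algebra.smul_def]
  refine ⟨c, ?_, ⟨⟨?_, fun x => ?_⟩⟩⟩
  · rintro rfl
    rw [zero_smul] at hPH
    have h0 : (1 : Matrix (Fin n) (Fin n) ℍ[k, a, b]) = 0 := by
      calc (1 : Matrix (Fin n) (Fin n) ℍ[k, a, b])
          = G' * (Rᴴ * (Pᴴ * H' * P) * R) := by
            rw [mul_assoc, mul_assoc Pᴴ, mul_assoc Pᴴ, ← mul_assoc Rᴴ, ← conjTranspose_mul,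
              hPR, conjTranspose_one, one_mul, mul_assoc, hPR, mul_one, hG'H']
        _ = 0 := by rw [hPH]; simp
    exact one_ne_zero h0
  · exact
      { toFun := (R *ᵥ ·)
        invFun := (P *ᵥ ·)
        map_add' := mulVec_add R
        map_smul' := fun c x => mulVec_smul R c x
        left_inv := fun x => by simp [mulVec_mulVec, hPR]
        right_inv := fun x => by simp [mulVec_mulVec, hRP] }
  · change c * qH (R *ᵥ x) = qH' x
    rw [← hq, mulVec_mulVec, hPR, one_mulVec]
end
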